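/- Let X be a spherical 2-design of size n in √m S^{m-1} which is an s-distance set of degree S = s, with projection matrices {F_i}_{i=0}^s and predegree polynomials {q_i}. If F_s = (1/n)q_s((nG)^∘), then F_k = (1/n)q_k((nG)^∘) for all k ∈ {0,1,…,s}; consequently X carries the structure of a Q-polynomial association scheme with respect to the idempotents {F_i}_{i=0}^s. -/

import Mathlib

open scoped InnerProductSpace Classical

noncomputable section

variable {V : Type*} [NormedAddCommGroup V] [InnerProductSpace ℝ V]

/-- `X` lies on the sphere of squared radius `m` (radius `√m`). -/
def onSphere (m : ℝ) (X : Finset V) : Prop := ∀ x ∈ X, ⟪x, x⟫_ℝ = m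

/-- The normalized Gram matrix `G` of `X`. -/
def gram (X : Finset V) : Matrix X X ℝ :=
  Matrix.of fun x y => (1 / (X.card : ℝ)) * ⟪(x : V), (y : V)⟫_ℝ

/-- The two conditions characterizing spherical 2-designs: `GJ = 0` and `G² = G`. -/
def IsTwoDesign (X : Finset V) : Prop :=
  (∀ x ∈ X, ∑ y ∈ X, ⟪x, y⟫_ℝ = 0) ∧
  (∀ x ∈ X, ∀ y ∈ X, (1 / (X.card : ℝ)) * ∑ z ∈ X, ⟪x, z⟫_ℝ * ⟪z, y⟫_ℝ = ⟪x, y⟫_ℝ)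

/-- `Pol_k(X)`: span of the zonal polynomials of degree at most `k`. -/
def Pol (X : Finset V) (k : ℕ) : Submodule ℝ (X → ℝ) :=
  Submodule.span ℝ {f | ∃ a ∈ X, ∃ p : Polynomial ℝ,
    p.natDegree ≤ k ∧ f = fun x => p.eval ⟪a, x.1⟫_ℝ}

/-- The inner product `(f,g) = (1/n) ∑ f(x) g(x)` on `C(X)`. -/
def inn (X : Finset V) (f g : X → ℝ) : ℝ := (1 / (X.card : ℝ)) * ∑ x, f x * g x

def innL (X : Finset V) (f : X → ℝ) : (X → ℝ) →ₗ[ℝ] ℝ where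
  toFun g := inn X f g
  map_add' g h := by
    simp only [inn, Pi.add_apply, mul_add, Finset.sum_add_distrib]
  map_smul' c g := by
    simp only [inn, Pi.smul_apply, smul_eq_mul, RingHom.id_apply]
    rw [Finset.sum_congr rfl (fun x _ => by ring : ∀ x ∈ Finset.univ, f x * (c * g x) = c * (f x * g x)),
      ← Finset.mul_sum]
    ring

/-- The orthogonal complement of `W` with respect to `inn`. -/
def perp (X : Finset V) (W : Submodule ℝ (X → ℝ)) : Submodule ℝ (X → ℝ) :=
  ⨅ f ∈ W, LinearMap.ker (innL X f)

/-- The harmonic spaces `Harm_k(X)`. -/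
def Harm (X : Finset V) : ℕ → Submodule ℝ (X → ℝ)
  | 0 => Pol X 0
  | (k+1) => Pol X (k+1) ⊓ perp X (Pol X k)

/-- `F` is the matrix of the orthogonal projection of `C(X)` onto `W`
(with respect to the inner product `inn`). -/
def IsProjOnto (X : Finset V) (W : Submodule ℝ (X → ℝ)) (F : Matrix X X ℝ) : Prop :=
  (∀ f, F.mulVec f ∈ W) ∧ (∀ f ∈ W, F.mulVec f = f) ∧ (∀ f ∈ perp X W, F.mulVec f = 0)

/-- The degree `S` of `X`: the least `i` with `Pol_i(X) = C(X)`. -/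
def degS (X : Finset V) : ℕ := sInf {i | Pol X i = ⊤}

/-- `A(X)`, the set of inner products between distinct points of `X`. -/
def Aset (X : Finset V) : Finset ℝ :=
  ((X ×ˢ X).filter fun p => p.1 ≠ p.2).image fun p => ⟪p.1, p.2⟫_ℝ

/-- `A'(X) = A(X) ∪ {m}`. -/
def Aset' (m : ℝ) (X : Finset V) : Finset ℝ := insert m (Aset X)

/-- `κ_α`, the number of ordered pairs of points of `X` with inner product `α`. -/
def kappa (X : Finset V) (α : ℝ) : ℕ := ((X ×ˢ X).filter fun p => ⟪p.1, p.2⟫_ℝ = α).card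

/-- The inner product `⟨p,q⟩ = (1/n²) ∑_{α ∈ A'(X)} κ_α p(α) q(α)` on polynomials. -/
def pInn (m : ℝ) (X : Finset V) (p q : Polynomial ℝ) : ℝ :=
  (1 / (X.card : ℝ) ^ 2) * ∑ α ∈ Aset' m X, (kappa X α : ℝ) * (p.eval α * q.eval α)

/-- `q` is the family of predegree polynomials of `X`. -/
def IsPredegree (m : ℝ) (X : Finset V) (s : ℕ) (q : ℕ → Polynomial ℝ) : Prop :=
  (∀ k ≤ s, (q k).natDegree = k ∧ q k ≠ 0) ∧
  (∀ k ≤ s, ∀ h ≤ s, pInn m X (q k) (q h) = if k = h then (q k).eval m else 0)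

/-- The relation matrix `A_α` of `X`. -/
def relMat (X : Finset V) (α : ℝ) : Matrix X X ℝ :=
  Matrix.of fun x y => if ⟪(x : V), (y : V)⟫_ℝ = α then 1 else 0

/-- `X` carries the structure of a `Q`-polynomial association scheme with respect to
the idempotents `F_0, …, F_s` (whose relations are given by the inner products). -/
def CarriesQPolyScheme (m : ℝ) (X : Finset V) (s : ℕ) (F : ℕ → Matrix X X ℝ) : Prop :=
  (∀ α ∈ Aset' m X, ∀ β ∈ Aset' m X, relMat X α * relMat X β ∈
      Submodule.span ℝ (relMat X '' (Aset' m X : Set ℝ))) ∧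
  (∀ i ≤ s, F i ∈ Submodule.span ℝ (relMat X '' (Aset' m X : Set ℝ))) ∧
  (∀ i ≤ s, ∀ j ≤ s, F i * F j = if i = j then F i else 0) ∧
  (∑ i ∈ Finset.range (s + 1), F i = 1) ∧
  (F 0 = Matrix.of fun _ _ => 1 / (X.card : ℝ)) ∧
  (∀ i ≤ s, ∃ v : Polynomial ℝ, v.natDegree = i ∧
      F i = Matrix.of fun x y => (1 / (X.card : ℝ)) * v.eval ((X.card : ℝ) * F 1 x y))


section Perp

variable {E : Type*} {X : Finset E}

lemma mem_perp_iff (hne : X.Nonempty) {W : Submodule ℝ (X → ℝ)} {f : X → ℝ} :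
    f ∈ perp X W ↔ ∀ g ∈ W, g ⬝ᵥ f = 0 := by
  have hn : (X.card : ℝ) ≠ 0 := by exact_mod_cast hne.card_pos.ne'
  simp only [perp, Submodule.mem_iInf, LinearMap.mem_ker]
  refine forall₂_congr fun g _ => ?_
  change (1 / (X.card : ℝ)) * (g ⬝ᵥ f) = 0 ↔ _
  simp [hn]

variable {W : Submodule ℝ (X → ℝ)} {F : Matrix X X ℝ}

lemma IsProjOnto.mul_self (hF : IsProjOnto X W F) : F * F = F := by
  refine Matrix.ext_of_mulVec_single fun x => ?_
  rw [← Matrix.mulVec_mulVec]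
  exact hF.2.1 _ (hF.1 _)

lemma IsProjOnto.transpose_eq (hne : X.Nonempty) (hF : IsProjOnto X W F) :
    F.transpose = F := by
  have key : F * (1 - F.transpose) = 0 := by
    refine Matrix.ext_of_mulVec_single fun x => ?_
    rw [← Matrix.mulVec_mulVec, Matrix.zero_mulVec]
    refine hF.2.2 _ ((mem_perp_iff hne).2 fun g hg => ?_)
    rw [← hF.2.1 g hg, ← Matrix.vecMul_transpose, ← Matrix.dotProduct_mulVec,
      Matrix.mulVec_mulVec, mul_sub, mul_one, ← Matrix.transpose_mul, hF.mul_self, sub_self,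
      Matrix.zero_mulVec, dotProduct_zero]
  rw [mul_sub, mul_one, sub_eq_zero] at key
  conv_lhs => rw [key]
  rw [Matrix.transpose_mul, Matrix.transpose_transpose, ← key]

end Perp

section HarmonicSpaces

variable {X : Finset V}

lemma Pol_mono {i j : ℕ} (hij : i ≤ j) : Pol X i ≤ Pol X j :=
  Submodule.span_mono fun _ ⟨a, ha, p, hp, hf⟩ => ⟨a, ha, p, hp.trans hij, hf⟩

lemma Harm_le_Pol (i : ℕ) : Harm X i ≤ Pol X i := by
  cases i with
  | zero => exact le_rfl
  | succ i => exact inf_le_left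

lemma dotProduct_eq_zero_of_mem_Harm (hne : X.Nonempty) {i j : ℕ} (hij : i < j)
    {f g : X → ℝ} (hf : f ∈ Pol X i) (hg : g ∈ Harm X j) : f ⬝ᵥ g = 0 := by
  cases j with
  | zero => omega
  | succ j => exact (mem_perp_iff hne).1 hg.2 f (Pol_mono (Nat.le_of_lt_succ hij) hf)

variable {F : ℕ → Matrix X X ℝ}

lemma mulVec_eq_zero_of_mem_Pol (hne : X.Nonempty) (hF : ∀ i, IsProjOnto X (Harm X i) (F i))
    {i j : ℕ} (hij : i < j) {f : X → ℝ} (hf : f ∈ Pol X i) : (F j).mulVec f = 0 :=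
  (hF j).2.2 _ ((mem_perp_iff hne).2 fun g hg => by
    rw [dotProduct_comm]; exact dotProduct_eq_zero_of_mem_Harm hne hij hf hg)

lemma projection_mul_projection (hne : X.Nonempty)
    (hF : ∀ i, IsProjOnto X (Harm X i) (F i)) (i j : ℕ) :
    F i * F j = if i = j then F i else 0 := by
  have lt_case : ∀ {i j : ℕ}, i < j → F j * F i = 0 := fun {i j} hij => by
    refine Matrix.ext_of_mulVec_single fun x => ?_
    rw [← Matrix.mulVec_mulVec, Matrix.zero_mulVec]
    exact mulVec_eq_zero_of_mem_Pol hne hF hij (Harm_le_Pol i ((hF i).1 _))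
  rcases lt_trichotomy i j with h | rfl | h
  · rw [if_neg h.ne, ← Matrix.transpose_eq_zero, Matrix.transpose_mul,
      (hF i).transpose_eq hne, (hF j).transpose_eq hne, lt_case h]
  · rw [if_pos rfl, (hF i).mul_self]
  · rw [if_neg h.ne', lt_case h]

lemma sum_projection_mulVec (hne : X.Nonempty)
    (hF : ∀ i, IsProjOnto X (Harm X i) (F i)) (k : ℕ) {f : X → ℝ} (hf : f ∈ Pol X k) :
    (∑ i ∈ Finset.range (k + 1), F i).mulVec f = f := by
  induction k generalizing f with
  | zero => simpa using (hF 0).2.1 f hf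
  | succ k ih =>
    set E := ∑ i ∈ Finset.range (k + 1), F i with hE
    have E_mem : E.mulVec f ∈ Pol X k := by
      rw [hE, Matrix.sum_mulVec]
      exact Submodule.sum_mem _ fun i hi =>
        Pol_mono (Nat.le_of_lt_succ (Finset.mem_range.1 hi)) (Harm_le_Pol i ((hF i).1 f))
    have E_symm : E.transpose = E := by
      rw [hE, Matrix.transpose_sum]
      exact Finset.sum_congr rfl fun i _ => (hF i).transpose_eq hne
    have harm : f - E.mulVec f ∈ Harm X (k + 1) := by
      refine ⟨Submodule.sub_mem _ hf (Pol_mono k.le_succ E_mem), (mem_perp_iff hne).2 ?_⟩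
      intro g hg
      rw [dotProduct_sub, Matrix.dotProduct_mulVec, ← E_symm, Matrix.vecMul_transpose, ih hg,
        sub_self]
    have := (hF (k + 1)).2.1 _ harm
    rw [Matrix.mulVec_sub, mulVec_eq_zero_of_mem_Pol hne hF k.lt_succ_self E_mem, sub_zero] at this
    rw [Finset.sum_range_succ, ← hE, Matrix.add_mulVec, this, add_sub_cancel]

end HarmonicSpaces

section Products

variable {m : ℕ} {X : Finset (EuclideanSpace ℝ (Fin m))}

lemma prod_inner_mem_span (k : ℕ) (v : Fin k → EuclideanSpace ℝ (Fin m)) :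
    (fun x : X => ∏ i, ⟪v i, x.1⟫_ℝ) ∈
      Submodule.span ℝ (Set.range fun (c : X) (x : X) => ⟪c.1, x.1⟫_ℝ ^ k) := by
  have expand : ∀ (w : Fin k → EuclideanSpace ℝ (Fin m)) (x : EuclideanSpace ℝ (Fin m)),
      ∏ i, ⟪w i, x⟫_ℝ = ∑ t : Fin k → Fin m, (∏ i, w i (t i)) * ∏ i, x (t i) := by
    intro w x
    simp only [PiLp.inner_apply, Finset.prod_univ_sum, Fintype.piFinset_univ,
      ← Finset.prod_mul_distrib]
    simp [mul_comm]
  by_contra hv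
  obtain ⟨φ, hφ, hφW⟩ := Submodule.exists_le_ker_of_notMem hv
  set u : X → ℝ := fun x => φ (Pi.single x 1) with hu
  have φ_apply : ∀ f : X → ℝ, φ f = ∑ x, f x * u x := fun f => by
    rw [LinearMap.pi_apply_eq_sum_univ φ f]
    simp only [hu, smul_eq_mul]
    refine Finset.sum_congr rfl fun x _ => ?_
    congr 2
    ext y
    simp [Pi.single_apply, eq_comm]
  have φ_prod : ∀ w : Fin k → EuclideanSpace ℝ (Fin m), φ (fun x : X => ∏ i, ⟪w i, x.1⟫_ℝ) =
      ∑ t : Fin k → Fin m, (∏ i, w i (t i)) * ∑ x : X, u x * ∏ i, x.1 (t i) := by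
    intro w
    rw [φ_apply]
    simp only [expand, Finset.sum_mul, Finset.mul_sum]
    rw [Finset.sum_comm]
    exact Finset.sum_congr rfl fun _ _ => Finset.sum_congr rfl fun _ _ => by ring
  have φ_pow : ∀ c : X, φ (fun x : X => ∏ _i : Fin k, ⟪c.1, x.1⟫_ℝ) = 0 := fun c => by
    have : (fun x : X => ∏ _i : Fin k, ⟪c.1, x.1⟫_ℝ) = fun x : X => ⟪c.1, x.1⟫_ℝ ^ k := by
      simp
    rw [this]
    exact hφW (Submodule.subset_span ⟨c, rfl⟩)
  have sq_sum : ∑ t : Fin k → Fin m, (∑ x : X, u x * ∏ i, x.1 (t i)) ^ 2 = 0 := by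
    have : ∑ c : X, u c * φ (fun x : X => ∏ _i : Fin k, ⟪c.1, x.1⟫_ℝ) = 0 := by
      exact Finset.sum_eq_zero fun c _ => by rw [φ_pow, mul_zero]
    rw [← this]
    simp only [φ_prod, Finset.mul_sum (s := (Finset.univ : Finset (Fin k → Fin m)))]
    rw [Finset.sum_comm]
    refine Finset.sum_congr rfl fun t _ => ?_
    rw [sq, Finset.sum_mul]
    exact Finset.sum_congr rfl fun _ _ => by ring
  rw [Finset.sum_eq_zero_iff_of_nonneg fun _ _ => sq_nonneg _] at sq_sum
  apply hφ
  rw [φ_prod]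
  refine Finset.sum_eq_zero fun t ht => ?_
  rw [pow_eq_zero_iff two_ne_zero |>.1 (sq_sum t ht), mul_zero]

lemma mul_inner_mem_Pol {k : ℕ} {f : X → ℝ} (hf : f ∈ Pol X k)
    (b : EuclideanSpace ℝ (Fin m)) : (fun x : X => f x * ⟪b, x.1⟫_ℝ) ∈ Pol X (k + 1) := by
  suffices Pol X k ≤ (Pol X (k + 1)).comap
      (LinearMap.mulRight ℝ (fun x : X => ⟪b, x.1⟫_ℝ)) from this hf
  refine Submodule.span_le.2 ?_
  rintro _ ⟨a, -, p, hp, rfl⟩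
  change (fun x : X => p.eval ⟪a, x.1⟫_ℝ * ⟪b, x.1⟫_ℝ) ∈ Pol X (k + 1)
  have : (fun x : X => p.eval ⟪a, x.1⟫_ℝ * ⟪b, x.1⟫_ℝ) =
      ∑ j ∈ Finset.range (k + 1), p.coeff j • fun x : X => ⟪a, x.1⟫_ℝ ^ j * ⟪b, x.1⟫_ℝ := by
    ext x
    rw [p.eval_eq_sum_range' (Nat.lt_succ_of_le hp), Finset.sum_mul]
    simp [mul_assoc]
  rw [this]
  refine Submodule.sum_mem _ fun j hj => Submodule.smul_mem _ _ ?_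
  have mem := prod_inner_mem_span (X := X) (j + 1) (Fin.cons b fun _ => a)
  simp only [Fin.prod_univ_succ, Fin.cons_zero, Fin.cons_succ, Finset.prod_const,
    Finset.card_univ, Fintype.card_fin] at mem
  have le : Submodule.span ℝ (Set.range fun (c : X) (x : X) => ⟪c.1, x.1⟫_ℝ ^ (j + 1)) ≤
      Pol X (k + 1) := by
    refine Submodule.span_le.2 ?_
    rintro _ ⟨c, rfl⟩
    refine Submodule.subset_span ⟨c.1, c.2, Polynomial.X ^ (j + 1), ?_, by simp⟩
    have := Finset.mem_range.1 hj
    simpa using by omega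
  convert le mem using 2
  ring

end Products

section PredegreePolynomials

variable {X : Finset V} {m : ℝ}

lemma inner_mem_Aset' (hsph : onSphere m X) (x y : X) : ⟪x.1, y.1⟫_ℝ ∈ Aset' m X := by
  by_cases hxy : x = y
  · subst hxy
    rw [hsph x x.2]
    exact Finset.mem_insert_self _ _
  · refine Finset.mem_insert_of_mem (Finset.mem_image.2 ⟨(x.1, y.1), ?_, rfl⟩)
    simpa using fun h => hxy (Subtype.ext h)

lemma exists_inner_eq (hne : X.Nonempty) (hsph : onSphere m X) {α : ℝ} (hα : α ∈ Aset' m X) :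
    ∃ x y : X, ⟪x.1, y.1⟫_ℝ = α := by
  rcases Finset.mem_insert.1 hα with rfl | hα
  · obtain ⟨x, hx⟩ := hne
    exact ⟨⟨x, hx⟩, ⟨x, hx⟩, hsph x hx⟩
  · obtain ⟨⟨x, y⟩, hxy, rfl⟩ := Finset.mem_image.1 hα
    simp only [Finset.mem_filter, Finset.mem_product] at hxy
    exact ⟨⟨x, hxy.1.1⟩, ⟨y, hxy.1.2⟩, rfl⟩

lemma inner_eq_iff (hsph : onSphere m X) (x y : X) : ⟪x.1, y.1⟫_ℝ = m ↔ x = y := by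
  refine ⟨fun h => Subtype.ext ?_, fun h => h ▸ hsph x x.2⟩
  rw [← sub_eq_zero, ← inner_self_eq_zero (𝕜 := ℝ), inner_sub_left, inner_sub_right,
    inner_sub_right, real_inner_comm x.1 y.1, h, hsph x x.2, hsph y y.2]
  ring

lemma card_Aset' (hsph : onSphere m X) : (Aset' m X).card = (Aset X).card + 1 := by
  refine Finset.card_insert_of_notMem fun h => ?_
  obtain ⟨⟨x, y⟩, hxy, e⟩ := Finset.mem_image.1 h
  simp only [Finset.mem_filter, Finset.mem_product] at hxy
  exact hxy.2 (congrArg Subtype.val ((inner_eq_iff hsph ⟨x, hxy.1.1⟩ ⟨y, hxy.1.2⟩).1 e))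

lemma pInn_eq_sum (hsph : onSphere m X) (p q : Polynomial ℝ) :
    pInn m X p q = (1 / (X.card : ℝ) ^ 2) *
      ∑ x : X, ∑ y : X, p.eval ⟪x.1, y.1⟫_ℝ * q.eval ⟪x.1, y.1⟫_ℝ := by
  rw [pInn]
  congr 1
  have h1 : ∑ x : X, ∑ y : X, p.eval ⟪x.1, y.1⟫_ℝ * q.eval ⟪x.1, y.1⟫_ℝ =
      ∑ z ∈ X ×ˢ X, p.eval ⟪z.1, z.2⟫_ℝ * q.eval ⟪z.1, z.2⟫_ℝ := by
    rw [Finset.sum_product, ← Finset.sum_coe_sort X]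
    refine Finset.sum_congr rfl fun x _ => ?_
    rw [← Finset.sum_coe_sort X]
  have maps : ∀ z ∈ X ×ˢ X, ⟪z.1, z.2⟫_ℝ ∈ Aset' m X := fun z hz =>
    inner_mem_Aset' hsph ⟨z.1, (Finset.mem_product.1 hz).1⟩ ⟨z.2, (Finset.mem_product.1 hz).2⟩
  rw [h1, ← Finset.sum_fiberwise_of_maps_to maps]
  refine Finset.sum_congr rfl fun α _ => ?_
  rw [kappa, ← nsmul_eq_mul, ← Finset.sum_const]
  refine Finset.sum_congr rfl fun z hz => ?_
  rw [(Finset.mem_filter.1 hz).2]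

/-- `pInn` as a bilinear map. -/
def pInnForm (m : ℝ) (X : Finset V) : Polynomial ℝ →ₗ[ℝ] Polynomial ℝ →ₗ[ℝ] ℝ :=
  LinearMap.mk₂ ℝ (pInn m X)
    (fun p p' q => by
      simp only [pInn, Polynomial.eval_add, add_mul, mul_add, Finset.sum_add_distrib])
    (fun c p q => by
      simp only [pInn, Polynomial.eval_smul, smul_eq_mul, Finset.mul_sum]
      exact Finset.sum_congr rfl fun _ _ => by ring)
    (fun p q q' => by
      simp only [pInn, Polynomial.eval_add, mul_add, Finset.sum_add_distrib])
    (fun c p q => by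
      simp only [pInn, Polynomial.eval_smul, smul_eq_mul, Finset.mul_sum]
      exact Finset.sum_congr rfl fun _ _ => by ring)

lemma eval_eq_zero_of_pInn_self (hne : X.Nonempty) (hsph : onSphere m X) {p : Polynomial ℝ}
    (hp : pInn m X p p = 0) (x y : X) : p.eval ⟪x.1, y.1⟫_ℝ = 0 := by
  have hn : (X.card : ℝ) ≠ 0 := by exact_mod_cast hne.card_pos.ne'
  rw [pInn_eq_sum hsph, mul_eq_zero, or_iff_right (by positivity),
    Finset.sum_eq_zero_iff_of_nonneg fun _ _ =>
      Finset.sum_nonneg fun _ _ => mul_self_nonneg _] at hp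
  have := hp x (Finset.mem_univ x)
  rw [Finset.sum_eq_zero_iff_of_nonneg fun _ _ => mul_self_nonneg _] at this
  exact mul_self_eq_zero.1 (this y (Finset.mem_univ y))

variable {s : ℕ} {q : ℕ → Polynomial ℝ}

lemma IsPredegree.mem_span (hq : IsPredegree m X s q) {k : ℕ} (hk : k ≤ s) {p : Polynomial ℝ}
    (hp : p.natDegree ≤ k) : p ∈ Submodule.span ℝ (q '' Set.Iic k) := by
  induction k generalizing p with
  | zero =>
    rw [Polynomial.eq_C_of_natDegree_le_zero hp]
    have h0 := hq.1 0 hk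
    have hc : (q 0).coeff 0 ≠ 0 := by
      intro h
      apply h0.2
      rw [Polynomial.eq_C_of_natDegree_eq_zero h0.1, h, Polynomial.C_0]
    have : Polynomial.C (p.coeff 0) = (p.coeff 0 / (q 0).coeff 0) • q 0 := by
      conv_rhs => rw [Polynomial.eq_C_of_natDegree_eq_zero h0.1]
      rw [Polynomial.smul_C]
      simp [hc]
    rw [this]
    exact Submodule.smul_mem _ _ (Submodule.subset_span ⟨0, by simp, rfl⟩)
  | succ k ih =>
    have hd := hq.1 (k + 1) hk
    have hc : (q (k + 1)).coeff (k + 1) ≠ 0 := by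
      have := Polynomial.leadingCoeff_ne_zero.2 hd.2
      rwa [Polynomial.leadingCoeff, hd.1] at this
    set c := p.coeff (k + 1) / (q (k + 1)).coeff (k + 1) with hcdef
    have low : (p - c • q (k + 1)).natDegree ≤ k := by
      refine Polynomial.natDegree_le_iff_coeff_eq_zero.2 fun N hN => ?_
      rw [Polynomial.coeff_sub, Polynomial.coeff_smul, smul_eq_mul]
      rcases (Nat.succ_le_of_lt hN).eq_or_lt with rfl | hN'
      · rw [hcdef, Nat.succ_eq_add_one, div_mul_cancel₀ _ hc, sub_self]
      · rw [Polynomial.coeff_eq_zero_of_natDegree_lt (hp.trans_lt hN'),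
          Polynomial.coeff_eq_zero_of_natDegree_lt (hd.1.trans_lt hN'), mul_zero, sub_zero]
    rw [← sub_add_cancel p (c • q (k + 1))]
    refine Submodule.add_mem _ (Submodule.span_mono (Set.image_mono ?_) (ih (by omega) low))
      (Submodule.smul_mem _ _ (Submodule.subset_span ⟨k + 1, by simp, rfl⟩))
    exact Set.Iic_subset_Iic.2 k.le_succ

lemma IsPredegree.pInn_eq_zero_of_natDegree_lt (hq : IsPredegree m X s q) {k : ℕ} (hk : k ≤ s)
    {p : Polynomial ℝ} (hp : p.natDegree < k) : pInn m X (q k) p = 0 := by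
  obtain ⟨j, rfl⟩ : ∃ j, k = j + 1 := ⟨k - 1, by omega⟩
  have mem := hq.mem_span (k := j) (by omega) (Nat.le_of_lt_succ hp)
  suffices Submodule.span ℝ (q '' Set.Iic j) ≤ LinearMap.ker (pInnForm m X (q (j + 1))) from
    this mem
  refine Submodule.span_le.2 ?_
  rintro _ ⟨i, hi, rfl⟩
  have hi' : i ≤ j := hi
  exact (hq.2 (j + 1) hk i (by omega)).trans (if_neg (by omega))

lemma eq_zero_of_natDegree_le (hne : X.Nonempty) (hsph : onSphere m X)
    (hs : (Aset X).card = s) {p : Polynomial ℝ} (hp : p.natDegree ≤ s)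
    (h : ∀ x y : X, p.eval ⟪x.1, y.1⟫_ℝ = 0) : p = 0 := by
  refine Polynomial.eq_zero_of_natDegree_lt_card_of_eval_eq_zero' p (Aset' m X) ?_ ?_
  · intro α hα
    obtain ⟨x, y, rfl⟩ := exists_inner_eq hne hsph hα
    exact h x y
  · rw [card_Aset' hsph]
    omega

lemma IsPredegree.eval_ne_zero (hne : X.Nonempty) (hsph : onSphere m X)
    (hs : (Aset X).card = s) (hq : IsPredegree m X s q) {k : ℕ} (hk : k ≤ s) :
    (q k).eval m ≠ 0 := by
  intro h
  have h0 := hq.2 k hk k hk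
  rw [if_pos rfl, h] at h0
  exact (hq.1 k hk).2 (eq_zero_of_natDegree_le hne hsph hs ((hq.1 k hk).1.trans_le hk)
    (eval_eq_zero_of_pInn_self hne hsph h0))

lemma pInn_X_mul (p r : Polynomial ℝ) :
    pInn m X (Polynomial.X * p) r = pInn m X p (Polynomial.X * r) := by
  simp only [pInn, Polynomial.eval_mul, Polynomial.eval_X]
  congr 1
  exact Finset.sum_congr rfl fun _ _ => by ring

lemma IsPredegree.pInn_X_mul_ne_zero (hne : X.Nonempty) (hsph : onSphere m X)
    (hs : (Aset X).card = s) (hq : IsPredegree m X s q) {k : ℕ} (hk : k < s) :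
    pInn m X (q (k + 1)) (Polynomial.X * q k) ≠ 0 := by
  intro h
  have hd := (hq.1 (k + 1) hk).1
  have hd' := hq.1 k hk.le
  have hc : (q k).coeff k ≠ 0 := by
    have := Polynomial.leadingCoeff_ne_zero.2 hd'.2
    rwa [Polynomial.leadingCoeff, hd'.1] at this
  set c := (q (k + 1)).coeff (k + 1) / (q k).coeff k with hcdef
  have low : (q (k + 1) - c • (Polynomial.X * q k)).natDegree ≤ k := by
    refine Polynomial.natDegree_le_iff_coeff_eq_zero.2 fun N hN => ?_
    obtain ⟨N, rfl⟩ : ∃ M, N = M + 1 := ⟨N - 1, by omega⟩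
    rw [Polynomial.coeff_sub, Polynomial.coeff_smul, Polynomial.coeff_X_mul, smul_eq_mul]
    rcases (Nat.le_of_lt_succ hN).eq_or_lt with rfl | hN'
    · rw [hcdef, div_mul_cancel₀ _ hc, sub_self]
    · rw [Polynomial.coeff_eq_zero_of_natDegree_lt (by omega),
        Polynomial.coeff_eq_zero_of_natDegree_lt (by omega), mul_zero, sub_zero]
  have orth := hq.pInn_eq_zero_of_natDegree_lt hk (Nat.lt_succ_of_le low)
  change pInnForm m X (q (k + 1)) _ = 0 at orth
  change pInnForm m X (q (k + 1)) _ = 0 at h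
  rw [map_sub, map_smul, h, smul_zero, sub_zero] at orth
  change pInn m X _ _ = 0 at orth
  rw [hq.2 _ hk _ hk, if_pos rfl] at orth
  exact hq.eval_ne_zero hne hsph hs hk orth

/-- Fourier expansion of a polynomial, as a function on `A'(X)`, in predegree polynomials. -/
lemma IsPredegree.eval_expansion (hne : X.Nonempty) (hsph : onSphere m X)
    (hs : (Aset X).card = s) (hq : IsPredegree m X s q) (f : Polynomial ℝ) (x y : X) :
    f.eval ⟪x.1, y.1⟫_ℝ = ∑ j ∈ Finset.range (s + 1),
      pInn m X f (q j) / (q j).eval m * (q j).eval ⟪x.1, y.1⟫_ℝ := by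
  set N : Polynomial ℝ := ∏ α ∈ Aset' m X, (Polynomial.X - Polynomial.C α) with hN
  have N_monic : N.Monic := Polynomial.monic_prod_of_monic _ _ fun α _ => Polynomial.monic_X_sub_C α
  have N_deg : N.natDegree = s + 1 := by
    rw [hN, Polynomial.natDegree_prod_of_monic _ _ fun α _ => Polynomial.monic_X_sub_C α]
    simp [card_Aset' hsph, hs]
  have eval_mod : ∀ x y : X, (f %ₘ N).eval ⟪x.1, y.1⟫_ℝ = f.eval ⟪x.1, y.1⟫_ℝ := fun x y => by
    conv_rhs => rw [← Polynomial.modByMonic_add_div f N]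
    have : N.eval ⟪x.1, y.1⟫_ℝ = 0 := by
      rw [hN, Polynomial.eval_prod]
      exact Finset.prod_eq_zero (inner_mem_Aset' hsph x y) (by simp)
    rw [Polynomial.eval_add, Polynomial.eval_mul, this, zero_mul, add_zero]
  have pInn_mod : ∀ p, pInn m X (f %ₘ N) p = pInn m X f p := fun p => by
    simp only [pInn_eq_sum hsph, eval_mod]
  set r := f %ₘ N - ∑ j ∈ Finset.range (s + 1), (pInn m X f (q j) / (q j).eval m) • q j with hr
  have r_deg : r.natDegree ≤ s := by
    refine (Polynomial.natDegree_sub_le _ _).trans (max_le ?_ ?_)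
    · have := Polynomial.natDegree_modByMonic_lt f N_monic
        (fun h => by rw [h] at N_deg; simp at N_deg)
      omega
    · refine Polynomial.natDegree_sum_le_of_forall_le _ _ fun j hj => ?_
      have hj' := Nat.le_of_lt_succ (Finset.mem_range.1 hj)
      exact (Polynomial.natDegree_smul_le _ _).trans ((hq.1 j hj').1.trans_le hj')
  have r_orth : ∀ k ≤ s, pInn m X r (q k) = 0 := fun k hk => by
    change pInnForm m X r (q k) = 0
    rw [hr, map_sub, LinearMap.sub_apply, map_sum, LinearMap.sum_apply,
      Finset.sum_eq_single_of_mem k (Finset.mem_range.2 (Nat.lt_succ_of_le hk))]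
    · rw [map_smul, LinearMap.smul_apply, smul_eq_mul]
      change pInn m X (f %ₘ N) (q k) - _ * pInn m X (q k) (q k) = 0
      rw [pInn_mod, hq.2 k hk k hk, if_pos rfl,
        div_mul_cancel₀ _ (hq.eval_ne_zero hne hsph hs hk), sub_self]
    · intro j hj hjk
      rw [map_smul, LinearMap.smul_apply, smul_eq_mul]
      change _ * pInn m X (q j) (q k) = 0
      rw [hq.2 j (Nat.le_of_lt_succ (Finset.mem_range.1 hj)) k hk, if_neg hjk, mul_zero]
  have r_self : pInn m X r r = 0 := by
    suffices Submodule.span ℝ (q '' Set.Iic s) ≤ LinearMap.ker (pInnForm m X r) from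
      this (hq.mem_span le_rfl r_deg)
    refine Submodule.span_le.2 ?_
    rintro _ ⟨k, hk, rfl⟩
    exact r_orth k hk
  have := eval_eq_zero_of_pInn_self hne hsph r_self x y
  rw [hr, Polynomial.eval_sub, eval_mod, sub_eq_zero, Polynomial.eval_finsetSum] at this
  simpa only [Polynomial.eval_smul, smul_eq_mul] using this

lemma IsPredegree.sum_eval (hne : X.Nonempty) (hsph : onSphere m X)
    (hs : (Aset X).card = s) (hq : IsPredegree m X s q) (x y : X) :
    ∑ j ∈ Finset.range (s + 1), (q j).eval ⟪x.1, y.1⟫_ℝ = if x = y then (X.card : ℝ) else 0 := by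
  have hn : (X.card : ℝ) ≠ 0 := by exact_mod_cast hne.card_pos.ne'
  set f := Lagrange.interpolate (Aset' m X) id fun α => if α = m then (X.card : ℝ) else 0
  have f_eval : ∀ x y : X, f.eval ⟪x.1, y.1⟫_ℝ = if x = y then (X.card : ℝ) else 0 := by
    intro x y
    have := Lagrange.eval_interpolate_at_node (fun α => if α = m then (X.card : ℝ) else 0)
      (Set.injOn_id _) (inner_mem_Aset' hsph x y)
    simp only [id, inner_eq_iff hsph] at this
    exact this
  rw [← f_eval, hq.eval_expansion hne hsph hs f x y]
  refine Finset.sum_congr rfl fun j hj => ?_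
  have : pInn m X f (q j) = (q j).eval m := by
    rw [pInn_eq_sum hsph]
    simp only [f_eval, ite_mul, zero_mul, Finset.sum_ite_eq, Finset.mem_univ, if_true]
    rw [Finset.sum_congr rfl fun x _ => by rw [hsph x.1 x.2]]
    simp only [Finset.sum_const, Finset.card_univ, Fintype.card_coe, nsmul_eq_mul]
    field_simp
  rw [this, div_self (hq.eval_ne_zero hne hsph hs (Nat.le_of_lt_succ (Finset.mem_range.1 hj))),
    one_mul]

end PredegreePolynomials

section ZonalMatrices

/-- The matrix `(1/n) p((nG)^∘)`. -/
def zonalMat (X : Finset V) (p : Polynomial ℝ) : Matrix X X ℝ :=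
  Matrix.of fun x y => (1 / (X.card : ℝ)) * p.eval ⟪x.1, y.1⟫_ℝ

variable {X : Finset V}

lemma zonalMat_mulVec_mem {p : Polynomial ℝ} {k : ℕ} (hp : p.natDegree ≤ k) (f : X → ℝ) :
    (zonalMat X p).mulVec f ∈ Pol X k := by
  have : (zonalMat X p).mulVec f =
      ∑ y : X, (1 / (X.card : ℝ) * f y) • fun x : X => p.eval ⟪y.1, x.1⟫_ℝ := by
    ext x
    simp only [zonalMat, Matrix.mulVec, dotProduct, Matrix.of_apply, Finset.sum_apply,
      Pi.smul_apply, smul_eq_mul]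
    refine Finset.sum_congr rfl fun y _ => ?_
    rw [real_inner_comm]
    ring
  rw [this]
  exact Submodule.sum_mem _ fun y _ => Submodule.smul_mem _ _
    (Submodule.subset_span ⟨y.1, y.2, p, hp, rfl⟩)

variable {F : ℕ → Matrix X X ℝ}

lemma projection_mul_zonalMat (hne : X.Nonempty) (hF : ∀ i, IsProjOnto X (Harm X i) (F i))
    {p : Polynomial ℝ} {j : ℕ} (hp : p.natDegree < j) : F j * zonalMat X p = 0 := by
  refine Matrix.ext_of_mulVec_single fun x => ?_
  rw [← Matrix.mulVec_mulVec, Matrix.zero_mulVec]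
  exact mulVec_eq_zero_of_mem_Pol hne hF hp (zonalMat_mulVec_mem le_rfl _)

lemma sum_projection_mul_zonalMat (hne : X.Nonempty)
    (hF : ∀ i, IsProjOnto X (Harm X i) (F i)) {p : Polynomial ℝ} {k : ℕ}
    (hp : p.natDegree ≤ k) : ∑ i ∈ Finset.range (k + 1), F i * zonalMat X p = zonalMat X p := by
  rw [← Finset.sum_mul]
  refine Matrix.ext_of_mulVec_single fun x => ?_
  rw [← Matrix.mulVec_mulVec]
  exact sum_projection_mulVec hne hF k (zonalMat_mulVec_mem hp _)

variable {m : ℝ} {s : ℕ} {q : ℕ → Polynomial ℝ}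

lemma IsPredegree.zonalMat_expansion (hne : X.Nonempty) (hsph : onSphere m X)
    (hs : (Aset X).card = s) (hq : IsPredegree m X s q) (f : Polynomial ℝ) :
    zonalMat X f = ∑ j ∈ Finset.range (s + 1),
      (pInn m X f (q j) / (q j).eval m) • zonalMat X (q j) := by
  ext x y
  simp only [zonalMat, Matrix.of_apply, Matrix.sum_apply, Matrix.smul_apply, smul_eq_mul]
  rw [hq.eval_expansion hne hsph hs f x y, Finset.mul_sum]
  exact Finset.sum_congr rfl fun _ _ => by ring

lemma IsPredegree.sum_zonalMat (hne : X.Nonempty) (hsph : onSphere m X)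
    (hs : (Aset X).card = s) (hq : IsPredegree m X s q) :
    ∑ j ∈ Finset.range (s + 1), zonalMat X (q j) = 1 := by
  have hn : (X.card : ℝ) ≠ 0 := by exact_mod_cast hne.card_pos.ne'
  ext x y
  simp only [zonalMat, Matrix.of_apply, Matrix.sum_apply, ← Finset.mul_sum,
    hq.sum_eval hne hsph hs, Matrix.one_apply]
  split_ifs <;> simp [hn]

lemma IsPredegree.mul_sum_zonalMat (hne : X.Nonempty) (hsph : onSphere m X)
    (hs : (Aset X).card = s) (hq : IsPredegree m X s q) (M : Matrix X X ℝ) :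
    M * ∑ j ∈ Finset.range (s + 1), zonalMat X (q j) = M := by
  rw [hq.sum_zonalMat hne hsph hs, mul_one]

lemma zonalMat_mem_span (hsph : onSphere m X) (p : Polynomial ℝ) :
    zonalMat X p ∈ Submodule.span ℝ (relMat X '' (Aset' m X : Set ℝ)) := by
  have : zonalMat X p = ∑ α ∈ Aset' m X, (1 / (X.card : ℝ) * p.eval α) • relMat X α := by
    ext x y
    simp only [zonalMat, relMat, Matrix.of_apply, Matrix.sum_apply, Matrix.smul_apply,
      smul_eq_mul, mul_ite, mul_one, mul_zero]
    rw [Finset.sum_ite_eq, if_pos (inner_mem_Aset' hsph x y)]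
  rw [this]
  exact Submodule.sum_mem _ fun α hα => Submodule.smul_mem _ _
    (Submodule.subset_span ⟨α, hα, rfl⟩)

lemma exists_zonalMat_eq_relMat (hne : X.Nonempty) (hsph : onSphere m X) (α : ℝ) :
    ∃ p : Polynomial ℝ, zonalMat X p = relMat X α := by
  have hn : (X.card : ℝ) ≠ 0 := by exact_mod_cast hne.card_pos.ne'
  refine ⟨Lagrange.interpolate (Aset' m X) id fun β => if β = α then (X.card : ℝ) else 0, ?_⟩
  ext x y
  have := Lagrange.eval_interpolate_at_node (fun β => if β = α then (X.card : ℝ) else 0)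
    (Set.injOn_id _) (inner_mem_Aset' hsph x y)
  simp only [id] at this
  simp only [zonalMat, relMat, Matrix.of_apply]
  rw [this]
  split_ifs <;> simp [hn]

end ZonalMatrices

section DownwardInduction

variable {m : ℕ} {X : Finset (EuclideanSpace ℝ (Fin m))} {F : ℕ → Matrix X X ℝ}

lemma projection_mul_hadamard (hne : X.Nonempty) (hF : ∀ i, IsProjOnto X (Harm X i) (F i))
    {p : Polynomial ℝ} {i k : ℕ} (hik : i + 1 < k) (hFk : F k = zonalMat X p) :
    F i * zonalMat X (Polynomial.X * p) = 0 := by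
  ext x z
  have row : (fun y => F i x y) ∈ Pol X i := by
    have : (F i).mulVec (Pi.single x 1) = fun y => F i x y := by
      ext y
      rw [Matrix.mulVec_single_one]
      exact congrFun₂ ((hF i).transpose_eq hne) x y
    exact this ▸ Harm_le_Pol i ((hF i).1 _)
  have col : (fun y => F k y z) ∈ Harm X k := by
    have : (F k).mulVec (Pi.single z 1) = fun y => F k y z := by
      ext y
      rw [Matrix.mulVec_single_one]
      rfl
    exact this ▸ (hF k).1 _
  have := dotProduct_eq_zero_of_mem_Harm hne hik (mul_inner_mem_Pol row z.1) col
  rw [Matrix.zero_apply, ← this, Matrix.mul_apply, dotProduct]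
  refine Finset.sum_congr rfl fun y _ => ?_
  rw [hFk]
  simp only [zonalMat, Matrix.of_apply, Polynomial.eval_mul, Polynomial.eval_X]
  rw [real_inner_comm]
  ring

variable {s : ℕ} {q : ℕ → Polynomial ℝ}

lemma projection_eq_zonalMat_pred (hne : X.Nonempty) (hsph : onSphere (m : ℝ) X)
    (hs : (Aset X).card = s) (hF : ∀ i, IsProjOnto X (Harm X i) (F i))
    (hq : IsPredegree (m : ℝ) X s q) {k : ℕ} (hk : k < s)
    (ih : ∀ j ≤ s, k < j → F j = zonalMat X (q j)) : F k = zonalMat X (q k) := by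
  have hdeg : ∀ j ≤ s, (q j).natDegree = j := fun j hj => (hq.1 j hj).1
  have low : ∀ i < k, F i * zonalMat X (q k) = 0 := by
    intro i hi
    have h0 := projection_mul_hadamard hne hF (i := i) (by omega) (ih (k + 1) hk k.lt_succ_self)
    rw [hq.zonalMat_expansion hne hsph hs, Finset.mul_sum,
      Finset.sum_eq_single_of_mem k (Finset.mem_range.2 (by omega)), Matrix.mul_smul,
      smul_eq_zero] at h0
    · refine h0.resolve_left (div_ne_zero ?_ (hq.eval_ne_zero hne hsph hs hk.le))
      rw [pInn_X_mul]
      exact hq.pInn_X_mul_ne_zero hne hsph hs hk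
    · intro j hj hjk
      have hj' := Nat.le_of_lt_succ (Finset.mem_range.1 hj)
      rw [Matrix.mul_smul, smul_eq_zero]
      rcases lt_or_gt_of_ne hjk with h | h
      · left
        rw [pInn_X_mul, hq.pInn_eq_zero_of_natDegree_lt hk, zero_div]
        have := hdeg j hj'
        exact Polynomial.natDegree_mul_le.trans_lt (by rw [Polynomial.natDegree_X]; omega)
      · right
        rw [← ih j hj' h, projection_mul_projection hne hF, if_neg (by omega)]
  have left : F k * zonalMat X (q k) = zonalMat X (q k) := by
    conv_rhs => rw [← sum_projection_mul_zonalMat hne hF (hdeg k hk.le).le]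
    rw [Finset.sum_range_succ, Finset.sum_eq_zero fun i hi => low i (Finset.mem_range.1 hi),
      zero_add]
  rw [← left]
  conv_lhs => rw [← hq.mul_sum_zonalMat hne hsph hs (F k), Finset.mul_sum]
  refine Finset.sum_eq_single_of_mem k (Finset.mem_range.2 (by omega)) fun j hj hjk => ?_
  have hj' := Nat.le_of_lt_succ (Finset.mem_range.1 hj)
  rcases lt_or_gt_of_ne hjk with h | h
  · exact projection_mul_zonalMat hne hF ((hdeg j hj').trans_lt h)
  · rw [← ih j hj' h, projection_mul_projection hne hF, if_neg h.ne]

lemma projection_eq_zonalMat (hne : X.Nonempty) (hsph : onSphere (m : ℝ) X)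
    (hs : (Aset X).card = s) (hF : ∀ i, IsProjOnto X (Harm X i) (F i))
    (hq : IsPredegree (m : ℝ) X s q) (h : F s = zonalMat X (q s)) {k : ℕ} (hk : k ≤ s) :
    F k = zonalMat X (q k) := by
  suffices ∀ d ≤ s, ∀ j ≤ s, s - d ≤ j → F j = zonalMat X (q j) from
    this s le_rfl k hk (by omega)
  intro d
  induction d with
  | zero =>
    intro _ j hj hj'
    obtain rfl : j = s := by omega
    exact h
  | succ d ih =>
    intro hd j hj hj'
    rcases hj'.eq_or_lt with rfl | hlt
    · exact projection_eq_zonalMat_pred hne hsph hs hF hq (by omega)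
        fun i hi hi' => ih (by omega) i hi (by omega)
    · exact ih (by omega) j hj (by omega)

end DownwardInduction

section LowDegree

variable {X : Finset V} {m : ℝ} {s : ℕ} {q : ℕ → Polynomial ℝ}

lemma IsPredegree.zero_eq_one (hne : X.Nonempty) (hsph : onSphere m X)
    (hs : (Aset X).card = s) (hq : IsPredegree m X s q) : q 0 = 1 := by
  have hn : (X.card : ℝ) ≠ 0 := by exact_mod_cast hne.card_pos.ne'
  obtain ⟨c, hc⟩ : ∃ c, q 0 = Polynomial.C c :=
    ⟨_, Polynomial.eq_C_of_natDegree_eq_zero (hq.1 0 s.zero_le).1⟩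
  have h0 := hq.2 0 s.zero_le 0 s.zero_le
  have hc0 := hq.eval_ne_zero hne hsph hs s.zero_le
  rw [if_pos rfl, pInn_eq_sum hsph, hc] at h0
  rw [hc, Polynomial.eval_C] at hc0
  simp only [Polynomial.eval_C, Finset.sum_const, Finset.card_univ, Fintype.card_coe,
    nsmul_eq_mul] at h0
  field_simp at h0
  rw [hc, h0, Polynomial.C_1]

lemma IsPredegree.one_eq_X (hne : X.Nonempty) (hsph : onSphere m X) (hdes : IsTwoDesign X)
    (hs : (Aset X).card = s) (hq : IsPredegree m X s q) (hs1 : 1 ≤ s) :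
    q 1 = Polynomial.X := by
  have hn : (X.card : ℝ) ≠ 0 := by exact_mod_cast hne.card_pos.ne'
  have sum_inner : ∀ x : X, ∑ y : X, ⟪x.1, y.1⟫_ℝ = 0 := fun x => by
    rw [Finset.sum_coe_sort X fun y => ⟪x.1, y⟫_ℝ, hdes.1 x x.2]
  have sum_inner_sq : ∀ x : X, ∑ y : X, ⟪x.1, y.1⟫_ℝ * ⟪x.1, y.1⟫_ℝ = X.card * m := fun x => by
    have := hdes.2 x x.2 x x.2
    rw [hsph x x.2] at this
    rw [← this, Finset.sum_coe_sort X fun y => ⟪x.1, y⟫_ℝ * ⟪x.1, y⟫_ℝ]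
    field_simp
    exact Finset.sum_congr rfl fun y _ => by rw [real_inner_comm x.1 y]; ring
  obtain ⟨a, b, hab⟩ : ∃ a b, q 1 = Polynomial.C a * Polynomial.X + Polynomial.C b :=
    ⟨_, _, Polynomial.eq_X_add_C_of_natDegree_le_one (hq.1 1 hs1).1.le⟩
  have hb : b = 0 := by
    have h01 := hq.2 1 hs1 0 s.zero_le
    rw [if_neg one_ne_zero, pInn_eq_sum hsph, hq.zero_eq_one hne hsph hs, hab] at h01
    simp only [Polynomial.eval_add, Polynomial.eval_mul, Polynomial.eval_C, Polynomial.eval_X,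
      Polynomial.eval_one, mul_one, Finset.sum_add_distrib, ← Finset.mul_sum, sum_inner, mul_zero,
      Finset.sum_const, Finset.card_univ, Fintype.card_coe, nsmul_eq_mul, zero_add] at h01
    simpa [hn, hne.ne_empty] using h01
  have h11 := hq.2 1 hs1 1 hs1
  have hm := hq.eval_ne_zero hne hsph hs hs1
  rw [if_pos rfl, pInn_eq_sum hsph, hab, hb] at h11
  rw [hab, hb] at hm
  simp only [Polynomial.eval_add, Polynomial.eval_mul, Polynomial.eval_C, Polynomial.eval_X,
    add_zero, mul_mul_mul_comm a, ← Finset.mul_sum, sum_inner_sq,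
    Finset.sum_const, Finset.card_univ, Fintype.card_coe, nsmul_eq_mul] at h11 hm
  have ha : a = 1 := by
    refine mul_right_cancel₀ hm ?_
    rw [one_mul]
    conv_rhs => rw [← h11]
    field_simp
  rw [hab, hb, ha, Polynomial.C_1, one_mul, Polynomial.C_0, add_zero]

end LowDegree

theorem statement_10 {m : ℕ} (X : Finset (EuclideanSpace ℝ (Fin m))) (hne : X.Nonempty)
    (hsph : onSphere (m : ℝ) X) (hdes : IsTwoDesign X) (s : ℕ) (hs : (Aset X).card = s)
    (hdeg : degS X = s)
    (F : ℕ → Matrix X X ℝ) (hF : ∀ i, IsProjOnto X (Harm X i) (F i))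
    (q : ℕ → Polynomial ℝ) (hq : IsPredegree (m : ℝ) X s q)
    (h : F s = Matrix.of fun x y => (1 / (X.card : ℝ)) * (q s).eval ⟪x.1, y.1⟫_ℝ) :
    (∀ k ≤ s, F k =
        Matrix.of fun x y => (1 / (X.card : ℝ)) * (q k).eval ⟪x.1, y.1⟫_ℝ) ∧
    CarriesQPolyScheme (m : ℝ) X s F := by
  have hn : (X.card : ℝ) ≠ 0 := by exact_mod_cast hne.card_pos.ne'
  have zonal : ∀ k ≤ s, F k = zonalMat X (q k) := fun k hk =>
    projection_eq_zonalMat hne hsph hs hF hq h hk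
  have F_mem : ∀ i ≤ s, F i ∈ Submodule.span ℝ (relMat X '' (Aset' (m : ℝ) X : Set ℝ)) :=
    fun i hi => zonal i hi ▸ zonalMat_mem_span hsph (q i)
  have relMat_eq : ∀ α, ∃ c : ℕ → ℝ, relMat X α = ∑ j ∈ Finset.range (s + 1), c j • F j := by
    intro α
    obtain ⟨p, hp⟩ := exists_zonalMat_eq_relMat hne hsph α
    refine ⟨fun j => pInn m X p (q j) / (q j).eval (m : ℝ),
      (hp.symm.trans (hq.zonalMat_expansion hne hsph hs p)).trans ?_⟩
    exact Finset.sum_congr rfl fun i hi => by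
      rw [zonal i (Nat.le_of_lt_succ (Finset.mem_range.1 hi))]
  refine ⟨zonal, ?_, F_mem, fun i _ j _ => projection_mul_projection hne hF i j, ?_, ?_, ?_⟩
  · intro α _ β _
    obtain ⟨c, hc⟩ := relMat_eq α
    obtain ⟨d, hd⟩ := relMat_eq β
    rw [hc, hd, Finset.sum_mul_sum]
    refine Submodule.sum_mem _ fun i hi => Submodule.sum_mem _ fun j _ => ?_
    rw [Matrix.smul_mul, Matrix.mul_smul, projection_mul_projection hne hF]
    refine Submodule.smul_mem _ _ (Submodule.smul_mem _ _ ?_)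
    split_ifs
    · exact F_mem i (Nat.le_of_lt_succ (Finset.mem_range.1 hi))
    · exact Submodule.zero_mem _
  · rw [Finset.sum_congr rfl fun i hi => zonal i (Nat.le_of_lt_succ (Finset.mem_range.1 hi))]
    exact hq.sum_zonalMat hne hsph hs
  · rw [zonal 0 s.zero_le, hq.zero_eq_one hne hsph hs]
    ext x y
    simp [zonalMat]
  · intro i hi
    refine ⟨q i, (hq.1 i hi).1, ?_⟩
    rw [zonal i hi]
    rcases Nat.eq_zero_or_pos i with rfl | hpos
    · rw [hq.zero_eq_one hne hsph hs]
      ext x y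
      simp [zonalMat]
    · rw [zonal 1 (by omega), hq.one_eq_X hne hsph hdes hs (by omega)]
      ext x y
      simp only [zonalMat, Matrix.of_apply, Polynomial.eval_X]
      rw [← mul_assoc, mul_one_div_cancel hn, one_mul]

end
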